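/- Let n ≥ 1, γ ≥ 0 and u₀ ∈ L^{1,γ}(ℝⁿ). Then lim_{t→∞} t^{n/4+γ/2} · ( ∫_{|ξ|≤1} | E₀(t,ξ) û₀(ξ) − Σ_{k=0}^{⌊γ⌋} e₀^k(t,ξ) ( Σ_{j=0}^{⌊γ⌋−k} m[u₀]^j(ξ) ) |² dξ )^{1/2} = 0. -/

import Mathlib

open MeasureTheory Filter

noncomputable section

/-- Euclidean space `ℝⁿ`. -/
abbrev Rn (n : ℕ) := EuclideanSpace ℝ (Fin n)

/-- Fourier transform `f̂(ξ) = ∫ e^{-i x·ξ} f(x) dx` of a real-valued `f`. -/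
def fourierHat (n : ℕ) (f : Rn n → ℝ) (ξ : Rn n) : ℂ :=
  ∫ x : Rn n, Complex.exp (-Complex.I * ((∑ i, x i * ξ i : ℝ) : ℂ)) * (f x : ℂ)

/-- Membership in the weighted space `L^{1,γ}(ℝⁿ)`. -/
def MemL1w (n : ℕ) (γ : ℝ) (f : Rn n → ℝ) : Prop :=
  MeasureTheory.Integrable f ∧
    MeasureTheory.Integrable (fun x : Rn n => (1 + ‖x‖) ^ γ * |f x|)

/-- The weighted norm `‖f‖_{1,γ}`. -/
def wnorm (n : ℕ) (γ : ℝ) (f : Rn n → ℝ) : ℝ :=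
  ∫ x : Rn n, (1 + ‖x‖) ^ γ * |f x|

/-- The evolution operator multiplier `E₀(t,ξ)`. -/
def E0 (n : ℕ) (t : ℝ) (ξ : Rn n) : ℝ :=
  if ‖ξ‖ ≤ 2 then
    Real.exp (-(t * ‖ξ‖ ^ 2) / 2) * Real.cos (t * ‖ξ‖ * Real.sqrt (4 - ‖ξ‖ ^ 2) / 2)
  else
    Real.exp (-(t * ‖ξ‖ ^ 2) / 2) * Real.cosh (t * ‖ξ‖ * Real.sqrt (‖ξ‖ ^ 2 - 4) / 2)

/-- The evolution operator multiplier `E₁(t,ξ)`. -/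
def E1 (n : ℕ) (t : ℝ) (ξ : Rn n) : ℝ :=
  if ‖ξ‖ ≤ 2 then
    Real.exp (-(t * ‖ξ‖ ^ 2) / 2) *
      (Real.sin (t * ‖ξ‖ * Real.sqrt (4 - ‖ξ‖ ^ 2) / 2) /
        (‖ξ‖ * Real.sqrt (4 - ‖ξ‖ ^ 2) / 2))
  else
    Real.exp (-(t * ‖ξ‖ ^ 2) / 2) *
      (Real.sinh (t * ‖ξ‖ * Real.sqrt (‖ξ‖ ^ 2 - 4) / 2) /
        (‖ξ‖ * Real.sqrt (‖ξ‖ ^ 2 - 4) / 2))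

/-- `L₀(a,t,ξ)` as a function of `a`. -/
def L0fun (n : ℕ) (t : ℝ) (ξ : Rn n) (a : ℝ) : ℝ :=
  Real.cos (t * ‖ξ‖ - t * ‖ξ‖ ^ 2 * (a / (4 + 2 * Real.sqrt (4 - a ^ 2))))

/-- `L₁(a,t,ξ)` as a function of `a`. -/
def L1fun (n : ℕ) (t : ℝ) (ξ : Rn n) (a : ℝ) : ℝ :=
  Real.sin (t * ‖ξ‖ - t * ‖ξ‖ ^ 2 * (a / (4 + 2 * Real.sqrt (4 - a ^ 2)))) /
    (‖ξ‖ * Real.sqrt (4 - a ^ 2) / 2)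

/-- `e₀^k(t,ξ) = e^{-t|ξ|²/2} (1/k!) (∂^k L₀/∂a^k)(0,t,ξ) |ξ|^k`. -/
def e0 (n : ℕ) (k : ℕ) (t : ℝ) (ξ : Rn n) : ℝ :=
  Real.exp (-(t * ‖ξ‖ ^ 2) / 2) * ((1 : ℝ) / k.factorial) *
    iteratedDeriv k (L0fun n t ξ) 0 * ‖ξ‖ ^ k

/-- `e₁^k(t,ξ) = e^{-t|ξ|²/2} (1/k!) (∂^k L₁/∂a^k)(0,t,ξ) |ξ|^k`. -/
def e1 (n : ℕ) (k : ℕ) (t : ℝ) (ξ : Rn n) : ℝ :=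
  Real.exp (-(t * ‖ξ‖ ^ 2) / 2) * ((1 : ℝ) / k.factorial) *
    iteratedDeriv k (L1fun n t ξ) 0 * ‖ξ‖ ^ k

/-- The moment polynomial
`m[f]^k(ξ) = ∑_{|α|=k} ((-1)^{|α|}/α!) (∫ x^α f(x) dx) (iξ)^α`. -/
def mom (n : ℕ) (f : Rn n → ℝ) (k : ℕ) (ξ : Rn n) : ℂ :=
  ∑ α ∈ Finset.univ.filter (fun α : Fin n → Fin (k + 1) => ∑ i, (α i).val = k),
    ((-1 : ℂ) ^ k / ∏ i, ((α i).val.factorial : ℂ)) *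
      ((∫ x : Rn n, (∏ i, x i ^ (α i).val) * f x : ℝ) : ℂ) *
      ∏ i, (Complex.I * (ξ i : ℂ)) ^ (α i).val

/-- The Fourier-space solution of the strongly damped wave equation. -/
def uhat (n : ℕ) (u₀ u₁ : Rn n → ℝ) (t : ℝ) (ξ : Rn n) : ℂ :=
  (E0 n t ξ : ℂ) * fourierHat n u₀ ξ +
    (E1 n t ξ : ℂ) * (((‖ξ‖ ^ 2 / 2 : ℝ) : ℂ) * fourierHat n u₀ ξ + fourierHat n u₁ ξ)

/-- Taylor's estimate for the imaginary exponential. -/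
theorem norm_cexp_sub_sum_le_pow (m : ℕ) (y : ℝ) :
    ‖Complex.exp (-Complex.I * (y : ℂ)) -
      ∑ j ∈ Finset.range m, (-Complex.I * (y : ℂ)) ^ j / (j.factorial : ℂ)‖ ≤ |y| ^ m := by
  induction m generalizing y with
  | zero => simp [Complex.norm_exp]
  | succ m ih =>
    let g : ℝ → ℂ := fun y => Complex.exp (-Complex.I * (y : ℂ)) -
      ∑ j ∈ Finset.range (m + 1), (-Complex.I * (y : ℂ)) ^ j / (j.factorial : ℂ)
    have hlin (x : ℝ) : HasDerivAt (fun y : ℝ => -Complex.I * (y : ℂ)) (-Complex.I) x := by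
      simpa using (Complex.ofRealCLM.hasDerivAt (x := x)).const_mul (-Complex.I)
    have hg (x : ℝ) : HasDerivAt g (-Complex.I * (Complex.exp (-Complex.I * (x : ℂ)) -
        ∑ j ∈ Finset.range m, (-Complex.I * (x : ℂ)) ^ j / (j.factorial : ℂ))) x := by
      have h1 := (hlin x).cexp
      have h2 : HasDerivAt (fun y : ℝ => ∑ j ∈ Finset.range (m + 1),
          (-Complex.I * (y : ℂ)) ^ j / (j.factorial : ℂ))
          (∑ j ∈ Finset.range (m + 1), ((j : ℂ) * (-Complex.I * (x : ℂ)) ^ (j - 1) *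
            (-Complex.I)) / (j.factorial : ℂ)) x :=
        HasDerivAt.fun_sum fun j _ => ((hlin x).pow j).div_const _
      refine (h1.sub h2).congr_deriv ?_
      rw [Finset.sum_range_succ', mul_sub, Finset.mul_sum]
      simp only [Nat.cast_zero, zero_mul, zero_div, add_zero]
      rw [mul_comm]
      congr 1
      refine Finset.sum_congr rfl fun j _ => ?_
      rw [Nat.factorial_succ, Nat.add_sub_cancel]
      have h0 : ((j : ℂ) + 1) ≠ 0 := by exact_mod_cast Nat.succ_ne_zero j
      have h3 : (j.factorial : ℂ) ≠ 0 := by exact_mod_cast j.factorial_ne_zero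
      push_cast
      field_simp
    have hb : ∀ x ∈ Set.uIcc 0 y, ‖-Complex.I * (Complex.exp (-Complex.I * (x : ℂ)) -
        ∑ j ∈ Finset.range m, (-Complex.I * (x : ℂ)) ^ j / (j.factorial : ℂ))‖ ≤ |y| ^ m := by
      intro x hx
      rw [norm_mul, norm_neg, Complex.norm_I, one_mul]
      refine (ih x).trans (pow_le_pow_left₀ (abs_nonneg _) ?_ _)
      simpa using Set.abs_sub_left_of_mem_uIcc hx
    have h0 : g 0 = 0 := by
      simp [g, Finset.sum_range_succ']
    have := (convex_uIcc (0 : ℝ) y).norm_image_sub_le_of_norm_hasDerivWithin_le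
      (fun x _ => (hg x).hasDerivWithinAt) hb Set.left_mem_uIcc Set.right_mem_uIcc
    rw [h0, sub_zero, sub_zero, Real.norm_eq_abs] at this
    rw [pow_succ]
    exact this

theorem norm_cexp_sub_sum_le_two_mul_pow (m : ℕ) (y : ℝ) :
    ‖Complex.exp (-Complex.I * (y : ℂ)) -
      ∑ j ∈ Finset.range (m + 1), (-Complex.I * (y : ℂ)) ^ j / (j.factorial : ℂ)‖ ≤
      2 * |y| ^ m := by
  rw [Finset.sum_range_succ, ← sub_sub, two_mul]
  refine (norm_sub_le _ _).trans (add_le_add (norm_cexp_sub_sum_le_pow m y) ?_)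
  rw [norm_div, norm_pow, norm_mul, norm_neg, Complex.norm_I, one_mul, Complex.norm_real,
    Real.norm_eq_abs, Complex.norm_natCast]
  exact div_le_self (by positivity) (by exact_mod_cast Nat.one_le_iff_ne_zero.2 m.factorial_ne_zero)

theorem norm_cexp_sub_sum_le_two_mul_rpow {γ : ℝ} (hγ : 0 ≤ γ) (y : ℝ) :
    ‖Complex.exp (-Complex.I * (y : ℂ)) -
      ∑ j ∈ Finset.range (⌊γ⌋₊ + 1), (-Complex.I * (y : ℂ)) ^ j / (j.factorial : ℂ)‖ ≤
      2 * |y| ^ γ := by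
  rcases le_total |y| 1 with h | h
  · refine (norm_cexp_sub_sum_le_pow _ y).trans ?_
    rcases (abs_nonneg y).eq_or_lt with h0 | h0
    · rw [← h0, zero_pow (Nat.succ_ne_zero _)]
      positivity
    · rw [← Real.rpow_natCast]
      have := Real.rpow_le_rpow_of_exponent_ge h0 h (Nat.lt_floor_add_one γ).le
      push_cast
      linarith [Real.rpow_nonneg (abs_nonneg y) γ]
  · refine (norm_cexp_sub_sum_le_two_mul_pow _ y).trans ?_
    rw [← Real.rpow_natCast]
    have := Real.rpow_le_rpow_of_exponent_le h (Nat.floor_le hγ)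
    linarith

theorem exists_pow_one_add_le_exp (p : ℕ) : ∃ C : ℝ, 0 ≤ C ∧ ∀ s : ℝ, 0 ≤ s →
    (1 + s) ^ p * Real.exp (-s / 2) ≤ C * Real.exp (-s / 4) := by
  refine ⟨4 ^ p * p.factorial * Real.exp (1 / 4), by positivity, fun s hs => ?_⟩
  have h := Real.pow_div_factorial_le_exp ((1 + s) / 4) (by positivity) p
  have h1 : (1 + s) ^ p ≤ 4 ^ p * p.factorial * Real.exp ((1 + s) / 4) := by
    rw [div_pow, div_div, div_le_iff₀ (by positivity)] at h
    linarith
  calc (1 + s) ^ p * Real.exp (-s / 2)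
      ≤ 4 ^ p * p.factorial * Real.exp ((1 + s) / 4) * Real.exp (-s / 2) := by gcongr
    _ = 4 ^ p * p.factorial * Real.exp (1 / 4) * Real.exp (-s / 4) := by
        rw [mul_assoc, mul_assoc (_ * _), ← Real.exp_add, ← Real.exp_add]
        ring_nf

theorem exists_rpow_mul_exp_le {p : ℝ} (hp : 0 ≤ p) : ∃ C : ℝ, 0 ≤ C ∧ ∀ s : ℝ, 0 ≤ s →
    s ^ p * Real.exp (-s / 2) ≤ C * Real.exp (-s / 4) := by
  obtain ⟨C, hC, h⟩ := exists_pow_one_add_le_exp ⌈p⌉₊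
  refine ⟨C, hC, fun s hs => le_trans ?_ (h s hs)⟩
  gcongr
  rw [← Real.rpow_natCast]
  calc s ^ p ≤ (1 + s) ^ p := Real.rpow_le_rpow hs (by linarith) hp
    _ ≤ _ := Real.rpow_le_rpow_of_exponent_le (by linarith) (Nat.le_ceil p)

/-- The phase correction of the propagator as a function of the frozen parameter. -/
def phaseShift (a : ℝ) : ℝ := a / (4 + 2 * Real.sqrt (4 - a ^ 2))

theorem contDiffAt_phaseShift {a : ℝ} (ha : a ∈ Set.Icc (0 : ℝ) 1) (N : ℕ∞) :
    ContDiffAt ℝ N phaseShift a := by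
  have h : (4 - a ^ 2) ≠ 0 := by nlinarith [ha.1, ha.2]
  have h2 : 4 + 2 * Real.sqrt (4 - a ^ 2) ≠ 0 := by positivity
  exact contDiffAt_id.div (contDiffAt_const.add (contDiffAt_const.mul
    ((contDiffAt_const.sub (contDiffAt_id.pow 2)).sqrt h))) h2

theorem exists_norm_iteratedDerivWithin_cos_phase_le (m : ℕ) : ∃ C : ℝ, 0 ≤ C ∧
    ∀ b s : ℝ, 0 ≤ s → ∀ a ∈ Set.Icc (0 : ℝ) 1,
      ‖iteratedDerivWithin m (fun a => Real.cos (b - s * phaseShift a)) (Set.Icc 0 1) a‖ ≤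
        C * (1 + s) ^ m := by
  have hu : UniqueDiffOn ℝ (Set.Icc (0 : ℝ) 1) := uniqueDiffOn_Icc one_pos
  have hφ : ContDiffOn ℝ m phaseShift (Set.Icc (0 : ℝ) 1) :=
    fun a ha => (contDiffAt_phaseShift ha m).contDiffWithinAt
  have hbd (i : ℕ) (hi : i ≤ m) : ∃ M : ℝ, ∀ a ∈ Set.Icc (0 : ℝ) 1,
      ‖iteratedFDerivWithin ℝ i phaseShift (Set.Icc 0 1) a‖ ≤ M :=
    isCompact_Icc.exists_bound_of_continuousOn
      (hφ.continuousOn_iteratedFDerivWithin (by exact_mod_cast hi) hu)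
  choose! M hM using hbd
  obtain ⟨B, hB⟩ : ∃ B : ℝ, 0 ≤ B ∧ ∀ i ≤ m, M i ≤ B := by
    refine ⟨∑ i ∈ Finset.range (m + 1), |M i|, by positivity, fun i hi => ?_⟩
    exact (le_abs_self _).trans (Finset.single_le_sum (f := fun i => |M i|)
      (fun _ _ => abs_nonneg _) (Finset.mem_range.2 (by omega)))
  refine ⟨m.factorial * (1 + B) ^ m, by have := hB.1; positivity, fun b s hs a ha => ?_⟩
  have hB0 := hB.1
  rw [← norm_iteratedFDerivWithin_eq_norm_iteratedDerivWithin]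
  have key := norm_iteratedFDerivWithin_comp_le (𝕜 := ℝ) (g := Real.cos)
    (f := fun a => b - s * phaseShift a) (n := m) (N := m) (s := Set.Icc 0 1) (t := Set.univ)
    (x := a) Real.contDiff_cos.contDiffOn (contDiffOn_const.sub (contDiffOn_const.mul hφ))
    le_rfl uniqueDiffOn_univ hu (Set.mapsTo_univ _ _) ha (C := 1) (D := (1 + B) * (1 + s))
    (fun i _ => by
      rw [iteratedFDerivWithin_univ, norm_iteratedFDeriv_eq_norm_iteratedDeriv, Real.norm_eq_abs]
      exact Real.abs_iteratedDeriv_cos_le_one i _)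
    (fun i hi1 him => by
      have h1 : iteratedFDerivWithin ℝ i (fun a => b - s * phaseShift a) (Set.Icc 0 1) a =
          -(s • iteratedFDerivWithin ℝ i phaseShift (Set.Icc 0 1) a) := by
        have hi : ContDiffWithinAt ℝ i phaseShift (Set.Icc 0 1) a :=
          (contDiffAt_phaseShift ha i).contDiffWithinAt
        have e : (fun a => b - s * phaseShift a) = (fun _ => b) - s • phaseShift := by
          ext; simp
        have hsi : ContDiffWithinAt ℝ i (s • phaseShift) (Set.Icc 0 1) a := hi.const_smul s
        rw [e, iteratedFDerivWithin_sub_apply contDiffWithinAt_const hsi hu ha,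
          iteratedFDerivWithin_const_smul_apply hi hu ha,
          iteratedFDerivWithin_const_of_ne (by omega)]
        simp
      rw [h1, norm_neg, norm_smul, Real.norm_of_nonneg hs]
      calc s * ‖iteratedFDerivWithin ℝ i phaseShift (Set.Icc 0 1) a‖
          ≤ (1 + s) * (1 + B) := by
            gcongr
            · linarith
            · linarith [hM i him a ha, hB.2 i him]
        _ = ((1 + B) * (1 + s)) ^ 1 := by ring
        _ ≤ ((1 + B) * (1 + s)) ^ i := by
            refine pow_le_pow_right₀ ?_ hi1
            nlinarith)
  refine key.trans (le_of_eq ?_)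
  rw [mul_pow]
  ring

theorem E0_eq_exp_mul_L0fun {n : ℕ} {t : ℝ} {ξ : Rn n} (hξ : ‖ξ‖ ≤ 1) :
    E0 n t ξ = Real.exp (-(t * ‖ξ‖ ^ 2) / 2) * L0fun n t ξ ‖ξ‖ := by
  have h0 := norm_nonneg ξ
  rw [E0, if_pos (by linarith), L0fun]
  congr 2
  have hq : 0 ≤ 4 - ‖ξ‖ ^ 2 := by nlinarith
  have hs := Real.sq_sqrt hq
  have h2 : 4 + 2 * Real.sqrt (4 - ‖ξ‖ ^ 2) ≠ 0 := by positivity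
  field_simp
  linear_combination (2 * t * ‖ξ‖) * hs

theorem contDiffAt_L0fun {n : ℕ} (t : ℝ) (ξ : Rn n) (m : ℕ) {a : ℝ} (ha : a ∈ Set.Icc (0 : ℝ) 1) :
    ContDiffAt ℝ m (L0fun n t ξ) a :=
  Real.contDiff_cos.contDiffAt.comp a (contDiffAt_const.sub
    (contDiffAt_const.mul (contDiffAt_phaseShift ha m)))

theorem exists_abs_e0_le (n k : ℕ) : ∃ C : ℝ, 0 ≤ C ∧ ∀ (t : ℝ) (ξ : Rn n), 0 ≤ t →
    |e0 n k t ξ| ≤ C * ‖ξ‖ ^ k * Real.exp (-(t * ‖ξ‖ ^ 2) / 4) := by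
  obtain ⟨A, hA, h1⟩ := exists_norm_iteratedDerivWithin_cos_phase_le k
  obtain ⟨B, hB, h2⟩ := exists_pow_one_add_le_exp k
  refine ⟨A * B, by positivity, fun t ξ ht => ?_⟩
  have hs : 0 ≤ t * ‖ξ‖ ^ 2 := by positivity
  have h3 := h1 (t * ‖ξ‖) (t * ‖ξ‖ ^ 2) hs 0 (by simp)
  change ‖iteratedDerivWithin k (L0fun n t ξ) (Set.Icc 0 1) 0‖ ≤ _ at h3
  rw [iteratedDerivWithin_eq_iteratedDeriv (uniqueDiffOn_Icc one_pos)
    (contDiffAt_L0fun t ξ k (by simp)) (by simp)] at h3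
  rw [e0, abs_mul, abs_mul, abs_mul, abs_of_pos (Real.exp_pos _), abs_of_nonneg
    (show (0 : ℝ) ≤ 1 / k.factorial by positivity), abs_of_nonneg (show 0 ≤ ‖ξ‖ ^ k by positivity)]
  have hf : (1 : ℝ) / k.factorial ≤ 1 :=
    div_le_self zero_le_one (by exact_mod_cast Nat.one_le_iff_ne_zero.2 k.factorial_ne_zero)
  rw [Real.norm_eq_abs] at h3
  calc _ ≤ Real.exp (-(t * ‖ξ‖ ^ 2) / 2) * 1 * (A * (1 + t * ‖ξ‖ ^ 2) ^ k) * ‖ξ‖ ^ k := by gcongr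
    _ = A * ‖ξ‖ ^ k * ((1 + t * ‖ξ‖ ^ 2) ^ k * Real.exp (-(t * ‖ξ‖ ^ 2) / 2)) := by ring
    _ ≤ A * ‖ξ‖ ^ k * (B * Real.exp (-(t * ‖ξ‖ ^ 2) / 4)) :=
        mul_le_mul_of_nonneg_left (h2 _ hs) (by positivity)
    _ = _ := by ring

theorem exists_abs_E0_sub_sum_e0_le (n N : ℕ) : ∃ C : ℝ, 0 ≤ C ∧ ∀ (t : ℝ) (ξ : Rn n), 0 ≤ t →
    ‖ξ‖ ≤ 1 → |E0 n t ξ - ∑ k ∈ Finset.range (N + 1), e0 n k t ξ| ≤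
      C * ‖ξ‖ ^ (N + 1) * Real.exp (-(t * ‖ξ‖ ^ 2) / 4) := by
  obtain ⟨A, hA, h1⟩ := exists_norm_iteratedDerivWithin_cos_phase_le (N + 1)
  obtain ⟨B, hB, h2⟩ := exists_pow_one_add_le_exp (N + 1)
  refine ⟨A * B, by positivity, fun t ξ ht hξ => ?_⟩
  have hs : 0 ≤ t * ‖ξ‖ ^ 2 := by positivity
  have h3 := taylor_mean_remainder_bound (f := L0fun n t ξ) (n := N) zero_le_one
    (fun a ha => (contDiffAt_L0fun t ξ (N + 1) ha).contDiffWithinAt) ⟨norm_nonneg ξ, hξ⟩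
    (fun a ha => h1 (t * ‖ξ‖) (t * ‖ξ‖ ^ 2) hs a ha)
  have h4 : ∑ k ∈ Finset.range (N + 1), e0 n k t ξ = Real.exp (-(t * ‖ξ‖ ^ 2) / 2) *
      taylorWithinEval (L0fun n t ξ) N (Set.Icc 0 1) 0 ‖ξ‖ := by
    rw [taylor_within_apply, Finset.mul_sum]
    refine Finset.sum_congr rfl fun k _ => ?_
    rw [iteratedDerivWithin_eq_iteratedDeriv (uniqueDiffOn_Icc one_pos)
      (contDiffAt_L0fun t ξ k (by simp)) (by simp), e0, sub_zero, smul_eq_mul]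
    ring
  rw [h4, E0_eq_exp_mul_L0fun hξ, ← mul_sub, abs_mul, abs_of_pos (Real.exp_pos _)]
  rw [Real.norm_eq_abs, sub_zero] at h3
  have h5 := h3.trans (div_le_self (by positivity)
    (by exact_mod_cast Nat.one_le_iff_ne_zero.2 N.factorial_ne_zero))
  calc _ ≤ Real.exp (-(t * ‖ξ‖ ^ 2) / 2) *
        (A * (1 + t * ‖ξ‖ ^ 2) ^ (N + 1) * ‖ξ‖ ^ (N + 1)) := by gcongr
    _ = A * ‖ξ‖ ^ (N + 1) *
        ((1 + t * ‖ξ‖ ^ 2) ^ (N + 1) * Real.exp (-(t * ‖ξ‖ ^ 2) / 2)) := by ring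
    _ ≤ A * ‖ξ‖ ^ (N + 1) * (B * Real.exp (-(t * ‖ξ‖ ^ 2) / 4)) :=
        mul_le_mul_of_nonneg_left (h2 _ hs) (by positivity)
    _ = _ := by ring

/-! ### Moment expansion of the Fourier transform -/

theorem abs_sum_mul_le_norm_mul_norm {n : ℕ} (x ξ : Rn n) : |∑ i, x i * ξ i| ≤ ‖x‖ * ‖ξ‖ := by
  have := abs_real_inner_le_norm ξ x
  rw [PiLp.inner_apply] at this
  simpa [mul_comm] using this

theorem pow_le_one_add_rpow {γ : ℝ} {j : ℕ} (hj : (j : ℝ) ≤ γ) {r : ℝ} (hr : 0 ≤ r) :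
    r ^ j ≤ (1 + r) ^ γ :=
  calc r ^ j ≤ (1 + r) ^ j := by gcongr; linarith
    _ = (1 + r) ^ (j : ℝ) := (Real.rpow_natCast _ _).symm
    _ ≤ (1 + r) ^ γ := Real.rpow_le_rpow_of_exponent_le (by linarith) hj

theorem MemL1w.integrable_mul {n : ℕ} {γ : ℝ} {u : Rn n → ℝ} (hu : MemL1w n γ u) {j : ℕ}
    (hj : (j : ℝ) ≤ γ) {p : Rn n → ℂ} (hp : Continuous p) {A : ℝ} (hA : 0 ≤ A)
    (hb : ∀ x, ‖p x‖ ≤ A * ‖x‖ ^ j) :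
    Integrable fun x => p x * (u x : ℂ) := by
  refine (hu.2.const_mul A).mono' (hp.aestronglyMeasurable.mul
    (Complex.continuous_ofReal.comp_aestronglyMeasurable hu.1.1)) (.of_forall fun x => ?_)
  rw [norm_mul, Complex.norm_real, Real.norm_eq_abs, ← mul_assoc]
  gcongr
  exact (hb x).trans (by gcongr; exact pow_le_one_add_rpow hj (norm_nonneg x))

theorem MemL1w.mom_eq_integral {n : ℕ} {γ : ℝ} {u : Rn n → ℝ} (hu : MemL1w n γ u) {j : ℕ}
    (hj : (j : ℝ) ≤ γ) (ξ : Rn n) :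
    mom n u j ξ = ∫ x : Rn n,
      (-Complex.I * ((∑ i, x i * ξ i : ℝ) : ℂ)) ^ j / (j.factorial : ℂ) * (u x : ℂ) := by
  have hexp (x : Rn n) :
      (-Complex.I * ((∑ i, x i * ξ i : ℝ) : ℂ)) ^ j / (j.factorial : ℂ) * (u x : ℂ) =
      ∑ α ∈ Finset.univ.piAntidiag j, ((-1 : ℂ) ^ j / ∏ i : Fin n, ((α i).factorial : ℂ)) *
        (∏ i, (Complex.I * (ξ i : ℂ)) ^ α i) * (((∏ i, x i ^ α i : ℝ) : ℂ) * (u x : ℂ)) := by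
    have e : -Complex.I * ((∑ i, x i * ξ i : ℝ) : ℂ) =
        -1 * ∑ i, ((x i : ℂ) * (Complex.I * (ξ i : ℂ))) := by
      push_cast
      rw [Finset.mul_sum, Finset.mul_sum]
      exact Finset.sum_congr rfl fun i _ => by ring
    rw [e, mul_pow, Finset.sum_pow_eq_sum_piAntidiag, Finset.mul_sum, Finset.sum_div,
      Finset.sum_mul]
    refine Finset.sum_congr rfl fun α hα => ?_
    have hm := Nat.multinomial_spec Finset.univ α
    rw [(Finset.mem_piAntidiag.1 hα).1] at hm
    have hm' : (∏ i, ((α i).factorial : ℂ)) * (Nat.multinomial Finset.univ α : ℂ) =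
        (j.factorial : ℂ) := by exact_mod_cast hm
    have h1 : (j.factorial : ℂ) ≠ 0 := by exact_mod_cast j.factorial_ne_zero
    have h2 : (∏ i, ((α i).factorial : ℂ)) ≠ 0 :=
      Finset.prod_ne_zero_iff.2 fun i _ => by exact_mod_cast (α i).factorial_ne_zero
    simp only [mul_pow (_ : ℂ) (_ * _), Finset.prod_mul_distrib]
    push_cast
    rw [← hm'] at h1 ⊢
    have h3 : (Nat.multinomial Finset.univ α : ℂ) ≠ 0 := right_ne_zero_of_mul h1
    field_simp
  have hint (α : Fin n → ℕ) (hα : α ∈ Finset.univ.piAntidiag j) :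
      Integrable fun x : Rn n => ((∏ i, x i ^ α i : ℝ) : ℂ) * (u x : ℂ) := by
    refine hu.integrable_mul hj (by fun_prop) zero_le_one fun x => ?_
    rw [Complex.norm_real, Real.norm_eq_abs, Finset.abs_prod, one_mul,
      ← (Finset.mem_piAntidiag.1 hα).1, ← Finset.prod_pow_eq_pow_sum]
    refine Finset.prod_le_prod (fun _ _ => abs_nonneg _) fun i _ => ?_
    rw [abs_pow]
    gcongr
    exact PiLp.norm_apply_le x i
  simp_rw [hexp]
  rw [integral_finsetSum _ fun α hα => (hint α hα).const_mul _, mom]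
  refine Finset.sum_nbij (fun α i => (α i).val) ?_ ?_ ?_ ?_
  · intro α hα
    simpa [Finset.mem_piAntidiag] using hα
  · intro α _ β _ h
    ext i
    exact congrFun h i
  · intro α hα
    have hs := (Finset.mem_piAntidiag.1 (Finset.mem_coe.1 hα)).1
    refine ⟨fun i => ⟨α i, Nat.lt_succ_of_le ?_⟩, by simpa using hs, rfl⟩
    rw [← hs]
    exact Finset.single_le_sum (f := α) (fun _ _ => Nat.zero_le _) (Finset.mem_univ i)
  · intro α _
    rw [integral_const_mul, ← integral_complex_ofReal]
    push_cast
    ring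

theorem continuous_phase {n : ℕ} (ξ : Rn n) :
    Continuous fun x : Rn n => -Complex.I * ((∑ i, x i * ξ i : ℝ) : ℂ) := by
  fun_prop

theorem MemL1w.fourierHat_sub_sum_mom {n : ℕ} {γ : ℝ} {u : Rn n → ℝ} (hu : MemL1w n γ u) {M : ℕ}
    (hM : (M : ℝ) ≤ γ) (ξ : Rn n) :
    fourierHat n u ξ - ∑ j ∈ Finset.range (M + 1), mom n u j ξ =
      ∫ x : Rn n, (Complex.exp (-Complex.I * ((∑ i, x i * ξ i : ℝ) : ℂ)) -
        ∑ j ∈ Finset.range (M + 1),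
          (-Complex.I * ((∑ i, x i * ξ i : ℝ) : ℂ)) ^ j / (j.factorial : ℂ)) * (u x : ℂ) := by
  have hj {j : ℕ} (h : j ∈ Finset.range (M + 1)) : (j : ℝ) ≤ γ :=
    le_trans (by exact_mod_cast Nat.lt_succ_iff.1 (Finset.mem_range.1 h)) hM
  have h1 : Integrable fun x : Rn n =>
      Complex.exp (-Complex.I * ((∑ i, x i * ξ i : ℝ) : ℂ)) * (u x : ℂ) := by
    refine hu.integrable_mul (j := 0) (by simpa using (hj (j := 0) (by simp)))
      (continuous_phase ξ).cexp zero_le_one fun x => ?_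
    simp [Complex.norm_exp]
  have h2 (j : ℕ) (h : j ∈ Finset.range (M + 1)) : Integrable fun x : Rn n =>
      (-Complex.I * ((∑ i, x i * ξ i : ℝ) : ℂ)) ^ j / (j.factorial : ℂ) * (u x : ℂ) := by
    refine hu.integrable_mul (hj h) (((continuous_phase ξ).pow j).div_const _)
      (A := ‖ξ‖ ^ j) (by positivity) fun x => ?_
    rw [norm_div, norm_pow, norm_mul, norm_neg, Complex.norm_I, one_mul, Complex.norm_real,
      Real.norm_eq_abs, Complex.norm_natCast, ← mul_pow, mul_comm ‖ξ‖]
    refine (div_le_self (by positivity)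
      (by exact_mod_cast Nat.one_le_iff_ne_zero.2 j.factorial_ne_zero)).trans ?_
    gcongr
    exact abs_sum_mul_le_norm_mul_norm x ξ
  simp_rw [sub_mul, Finset.sum_mul]
  rw [integral_sub h1 (integrable_finsetSum _ h2), integral_finsetSum _ h2, fourierHat]
  congr 1
  exact Finset.sum_congr rfl fun j h => hu.mom_eq_integral (hj h) ξ

theorem MemL1w.norm_fourierHat_sub_sum_mom_le {n : ℕ} {γ : ℝ} {u : Rn n → ℝ}
    (hu : MemL1w n γ u) {M : ℕ} (hM : (M : ℝ) + 1 ≤ γ) (ξ : Rn n) :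
    ‖fourierHat n u ξ - ∑ j ∈ Finset.range (M + 1), mom n u j ξ‖ ≤
      wnorm n γ u * ‖ξ‖ ^ (M + 1) := by
  rw [hu.fourierHat_sub_sum_mom (by linarith) ξ, wnorm, ← integral_mul_const]
  refine norm_integral_le_of_norm_le (hu.2.mul_const _) (.of_forall fun x => ?_)
  rw [norm_mul, Complex.norm_real, Real.norm_eq_abs]
  have h := (norm_cexp_sub_sum_le_pow (M + 1) (∑ i, x i * ξ i)).trans
    (pow_le_pow_left₀ (abs_nonneg _) (abs_sum_mul_le_norm_mul_norm x ξ) _)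
  rw [mul_pow] at h
  have h2 := pow_le_one_add_rpow (j := M + 1) (by exact_mod_cast hM) (norm_nonneg x)
  calc _ ≤ (1 + ‖x‖) ^ γ * ‖ξ‖ ^ (M + 1) * |u x| := by
        gcongr
        exact h.trans (by gcongr)
    _ = _ := by ring

theorem MemL1w.norm_fourierHat_le {n : ℕ} {γ : ℝ} (hγ : 0 ≤ γ) {u : Rn n → ℝ}
    (hu : MemL1w n γ u) (ξ : Rn n) : ‖fourierHat n u ξ‖ ≤ wnorm n γ u := by
  refine norm_integral_le_of_norm_le hu.2 (.of_forall fun x => ?_)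
  rw [norm_mul, Complex.norm_real, Real.norm_eq_abs]
  gcongr
  have : ‖Complex.exp (-Complex.I * ((∑ i, x i * ξ i : ℝ) : ℂ))‖ = 1 := by
    simp [Complex.norm_exp]
  rw [this]
  exact Real.one_le_rpow (by linarith [norm_nonneg x]) hγ

theorem MemL1w.exists_setIntegral_compl_closedBall_le {n : ℕ} {γ : ℝ} {u : Rn n → ℝ}
    (hu : MemL1w n γ u) {ε : ℝ} (hε : 0 < ε) : ∃ R : ℕ,
      ∫ x in (Metric.closedBall (0 : Rn n) R)ᶜ, (1 + ‖x‖) ^ γ * |u x| < ε := by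
  have h := tendsto_setIntegral_of_antitone (μ := volume)
    (s := fun R : ℕ => (Metric.closedBall (0 : Rn n) R)ᶜ)
    (f := fun x => (1 + ‖x‖) ^ γ * |u x|)
    (fun R => Metric.isClosed_closedBall.measurableSet.compl)
    (fun R S h => Set.compl_subset_compl.2 (Metric.closedBall_subset_closedBall
      (by exact_mod_cast h))) ⟨0, hu.2.integrableOn⟩
  have h0 : ⋂ R : ℕ, (Metric.closedBall (0 : Rn n) (R : ℝ))ᶜ = ∅ := by
    rw [← Set.compl_iUnion, Metric.iUnion_closedBall_nat, Set.compl_univ]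
  rw [h0, setIntegral_empty] at h
  exact (h.eventually (gt_mem_nhds hε)).exists

theorem MemL1w.exists_norm_fourierHat_sub_sum_mom_le {n : ℕ} {γ : ℝ} (hγ : 0 ≤ γ)
    {u : Rn n → ℝ} (hu : MemL1w n γ u) {ε : ℝ} (hε : 0 < ε) : ∃ K : ℝ, 0 ≤ K ∧ ∀ ξ : Rn n,
      ‖fourierHat n u ξ - ∑ j ∈ Finset.range (⌊γ⌋₊ + 1), mom n u j ξ‖ ≤
        ε * ‖ξ‖ ^ γ + K * ‖ξ‖ ^ (⌊γ⌋₊ + 1) := by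
  obtain ⟨R, hR⟩ := hu.exists_setIntegral_compl_closedBall_le (half_pos hε)
  set B := (Metric.closedBall (0 : Rn n) (R : ℝ))ᶜ with hB
  have hBm : MeasurableSet B := Metric.isClosed_closedBall.measurableSet.compl
  refine ⟨(R : ℝ) ^ (⌊γ⌋₊ + 1) * wnorm n γ u, mul_nonneg (by positivity)
    (integral_nonneg fun x => by positivity), fun ξ => ?_⟩
  set w : Rn n → ℝ := fun x => (1 + ‖x‖) ^ γ * |u x| with hw
  have hw0 (x : Rn n) : 0 ≤ w x := by positivity
  rw [hu.fourierHat_sub_sum_mom (Nat.floor_le hγ) ξ]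
  have hint : Integrable fun x => 2 * ‖ξ‖ ^ γ * B.indicator w x +
      (R : ℝ) ^ (⌊γ⌋₊ + 1) * ‖ξ‖ ^ (⌊γ⌋₊ + 1) * w x :=
    ((hu.2.indicator hBm).const_mul _).add (hu.2.const_mul _)
  refine (norm_integral_le_of_norm_le hint (.of_forall fun x => ?_)).trans ?_
  · rw [norm_mul, Complex.norm_real, Real.norm_eq_abs]
    have hy := abs_sum_mul_le_norm_mul_norm x ξ
    by_cases hx : x ∈ B
    · rw [Set.indicator_of_mem hx]
      have h1 : ‖x‖ ^ γ ≤ (1 + ‖x‖) ^ γ :=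
        Real.rpow_le_rpow (norm_nonneg _) (by linarith) hγ
      have h2 := Real.rpow_le_rpow (abs_nonneg _) hy hγ
      rw [Real.mul_rpow (norm_nonneg _) (norm_nonneg _)] at h2
      have h3 : 0 ≤ (R : ℝ) ^ (⌊γ⌋₊ + 1) * ‖ξ‖ ^ (⌊γ⌋₊ + 1) * w x :=
        mul_nonneg (by positivity) (hw0 x)
      calc _ ≤ 2 * ((1 + ‖x‖) ^ γ * ‖ξ‖ ^ γ) * |u x| := by
            gcongr
            refine (norm_cexp_sub_sum_le_two_mul_rpow hγ _).trans ?_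
            gcongr
            exact h2.trans (by gcongr)
        _ = 2 * ‖ξ‖ ^ γ * w x := by rw [hw]; ring
        _ ≤ _ := by linarith
    · rw [Set.indicator_of_notMem hx, mul_zero, zero_add]
      have hxR : ‖x‖ ≤ R := by simpa [hB] using hx
      have hu1 : |u x| ≤ w x :=
        le_mul_of_one_le_left (abs_nonneg _)
          (Real.one_le_rpow (by linarith [norm_nonneg x]) hγ)
      rw [← mul_pow]
      gcongr
      refine (norm_cexp_sub_sum_le_pow _ _).trans ?_
      gcongr
      exact hy.trans (by gcongr)
  · rw [integral_add ((hu.2.indicator hBm).const_mul _) (hu.2.const_mul _), integral_const_mul,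
      integral_const_mul, integral_indicator hBm]
    refine add_le_add ?_ (le_of_eq ?_)
    · have h4 : 0 ≤ ‖ξ‖ ^ γ := by positivity
      nlinarith
    · rw [wnorm]
      ring

/-! ### The low-frequency error -/

/-- The error of the asymptotic profile in Fourier space. -/
def profileError (n : ℕ) (N : ℕ) (u : Rn n → ℝ) (t : ℝ) (ξ : Rn n) : ℂ :=
  (E0 n t ξ : ℂ) * fourierHat n u ξ -
    ∑ k ∈ Finset.range (N + 1), (e0 n k t ξ : ℂ) *
      ∑ j ∈ Finset.range (N - k + 1), mom n u j ξ

theorem MemL1w.exists_norm_profileError_le {n : ℕ} {γ : ℝ} (hγ : 0 ≤ γ) {u : Rn n → ℝ}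
    (hu : MemL1w n γ u) {ε : ℝ} (hε : 0 < ε) : ∃ K : ℝ, 0 ≤ K ∧ ∀ (t : ℝ) (ξ : Rn n), 0 ≤ t →
      ‖ξ‖ ≤ 1 → ‖profileError n ⌊γ⌋₊ u t ξ‖ ≤
        (ε * ‖ξ‖ ^ γ + K * ‖ξ‖ ^ (⌊γ⌋₊ + 1)) * Real.exp (-(t * ‖ξ‖ ^ 2) / 4) := by
  have hNγ := Nat.floor_le hγ
  set N := ⌊γ⌋₊
  obtain ⟨A, hA, hE⟩ := exists_abs_E0_sub_sum_e0_le n N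
  choose C hC he using exists_abs_e0_le n
  have hW : 0 ≤ wnorm n γ u := integral_nonneg fun x => by positivity
  have hC0 : 0 < C 0 + 1 := by linarith [hC 0]
  obtain ⟨K, hK, hF⟩ := hu.exists_norm_fourierHat_sub_sum_mom_le hγ (div_pos hε hC0)
  set W := wnorm n γ u
  refine ⟨A * W + ∑ k ∈ Finset.range N, C (k + 1) * W + (C 0 + 1) * K,
    add_nonneg (add_nonneg (by positivity)
      (Finset.sum_nonneg fun k _ => mul_nonneg (hC _) hW)) (by positivity), fun t ξ ht hξ => ?_⟩
  set F := fourierHat n u ξ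
  set e := Real.exp (-(t * ‖ξ‖ ^ 2) / 4)
  have he0 : 0 ≤ e := (Real.exp_pos _).le
  have hsplit : profileError n N u t ξ =
      ((E0 n t ξ - ∑ k ∈ Finset.range (N + 1), e0 n k t ξ : ℝ) : ℂ) * F +
      (∑ k ∈ Finset.range N, (e0 n (k + 1) t ξ : ℂ) *
        (F - ∑ j ∈ Finset.range (N - (k + 1) + 1), mom n u j ξ) +
        (e0 n 0 t ξ : ℂ) * (F - ∑ j ∈ Finset.range (N + 1), mom n u j ξ)) := by
    have := Finset.sum_range_succ' (fun k => (e0 n k t ξ : ℂ) *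
        (F - ∑ j ∈ Finset.range (N - k + 1), mom n u j ξ)) N
    rw [Nat.sub_zero] at this
    rw [← this, profileError]
    simp only [mul_sub, Finset.sum_sub_distrib, ← Finset.sum_mul]
    push_cast
    ring
  have hb1 : ‖((E0 n t ξ - ∑ k ∈ Finset.range (N + 1), e0 n k t ξ : ℝ) : ℂ) * F‖ ≤
      A * ‖ξ‖ ^ (N + 1) * e * W := by
    rw [norm_mul, Complex.norm_real, Real.norm_eq_abs]
    exact mul_le_mul (hE t ξ ht hξ) (hu.norm_fourierHat_le hγ ξ) (norm_nonneg _) (by positivity)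
  have hb2 (k : ℕ) (hk : k ∈ Finset.range N) : ‖(e0 n (k + 1) t ξ : ℂ) *
      (F - ∑ j ∈ Finset.range (N - (k + 1) + 1), mom n u j ξ)‖ ≤
      C (k + 1) * W * (‖ξ‖ ^ (N + 1) * e) := by
    have hkN := Finset.mem_range.1 hk
    rw [norm_mul, Complex.norm_real, Real.norm_eq_abs]
    have h1 : ((N - (k + 1) : ℕ) : ℝ) + 1 ≤ γ := by
      refine le_trans ?_ hNγ
      exact_mod_cast (by omega : N - (k + 1) + 1 ≤ N)
    refine (mul_le_mul (he (k + 1) t ξ ht) (hu.norm_fourierHat_sub_sum_mom_le h1 ξ)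
      (norm_nonneg _) (mul_nonneg (mul_nonneg (hC _) (by positivity)) he0)).trans (le_of_eq ?_)
    have h2 : ‖ξ‖ ^ (N + 1) = ‖ξ‖ ^ (k + 1) * ‖ξ‖ ^ (N - (k + 1) + 1) := by
      rw [← pow_add]
      congr 1
      omega
    rw [h2]
    ring
  have hb3 : ‖(e0 n 0 t ξ : ℂ) * (F - ∑ j ∈ Finset.range (N + 1), mom n u j ξ)‖ ≤
      (C 0 + 1) * e * (ε / (C 0 + 1) * ‖ξ‖ ^ γ + K * ‖ξ‖ ^ (N + 1)) := by
    rw [norm_mul, Complex.norm_real, Real.norm_eq_abs]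
    refine mul_le_mul ((he 0 t ξ ht).trans ?_) (hF ξ) (norm_nonneg _) (by positivity)
    rw [pow_zero, mul_one]
    gcongr
    linarith
  rw [hsplit]
  refine (norm_add_le _ _).trans ((add_le_add hb1 ((norm_add_le _ _).trans
    (add_le_add ((norm_sum_le _ _).trans (Finset.sum_le_sum hb2)) hb3))).trans (le_of_eq ?_))
  rw [← Finset.sum_mul]
  field_simp
  ring

theorem exists_sq_rpow_mul_exp_le {p : ℝ} (hp : 0 ≤ p) : ∃ C : ℝ, 0 ≤ C ∧ ∀ t r : ℝ, 0 < t →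
    0 ≤ r → (r ^ p) ^ 2 * Real.exp (-(t * r ^ 2) / 2) ≤
      C * t ^ (-p) * Real.exp (-(t * r ^ 2) / 4) := by
  obtain ⟨C, hC, h⟩ := exists_rpow_mul_exp_le hp
  refine ⟨C, hC, fun t r ht hr => ?_⟩
  have h1 : (r ^ p) ^ 2 = t ^ (-p) * (t * r ^ 2) ^ p := by
    rw [Real.mul_rpow ht.le (by positivity), ← mul_assoc, ← Real.rpow_add ht, neg_add_cancel,
      Real.rpow_zero, one_mul, ← Real.rpow_natCast, ← Real.rpow_natCast, ← Real.rpow_mul hr,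
      ← Real.rpow_mul hr, mul_comm]
  calc _ = t ^ (-p) * ((t * r ^ 2) ^ p * Real.exp (-(t * r ^ 2) / 2)) := by rw [h1]; ring
    _ ≤ t ^ (-p) * (C * Real.exp (-(t * r ^ 2) / 4)) :=
        mul_le_mul_of_nonneg_left (h _ (by positivity)) (by positivity)
    _ = _ := by ring

theorem integrable_exp_neg_mul_sq_norm_div_four (n : ℕ) {t : ℝ} (ht : 0 < t) :
    Integrable fun ξ : Rn n => Real.exp (-(t * ‖ξ‖ ^ 2) / 4) := by
  have := (GaussianFourier.integrable_cexp_neg_mul_sq_norm_add (V := Rn n)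
    (b := ((t / 4 : ℝ) : ℂ)) (by simpa using ht) 0 0).norm
  refine this.congr (.of_forall fun ξ => ?_)
  simp only [Complex.norm_exp]
  congr 1
  rw [zero_mul, add_zero, ← Complex.ofReal_pow, ← Complex.ofReal_neg, ← Complex.ofReal_mul,
    Complex.ofReal_re]
  ring

theorem integral_exp_neg_mul_sq_norm_div_four (n : ℕ) {t : ℝ} (ht : 0 < t) :
    ∫ ξ : Rn n, Real.exp (-(t * ‖ξ‖ ^ 2) / 4) =
      (4 * Real.pi) ^ ((n : ℝ) / 2) * t ^ (-((n : ℝ) / 2)) := by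
  have h := GaussianFourier.integral_rexp_neg_mul_sq_norm (V := Rn n) (b := t / 4) (by positivity)
  rw [finrank_euclideanSpace_fin] at h
  rw [Real.rpow_neg ht.le, ← div_eq_mul_inv, ← Real.div_rpow (by positivity) ht.le]
  convert h using 2
  · ext ξ
    ring_nf
  · field_simp

theorem MemL1w.exists_rpow_mul_integral_profileError_le {n : ℕ} {γ : ℝ} (hγ : 0 ≤ γ)
    {u : Rn n → ℝ} (hu : MemL1w n γ u) : ∃ A : ℝ, 0 ≤ A ∧ ∀ ε : ℝ, 0 < ε → ∃ K : ℝ,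
      ∀ t : ℝ, 0 < t → t ^ ((n : ℝ) / 2 + γ) *
        ∫ ξ in Metric.closedBall (0 : Rn n) 1, ‖profileError n ⌊γ⌋₊ u t ξ‖ ^ 2 ≤
        A * ε ^ 2 + K * t ^ (-((⌊γ⌋₊ : ℝ) + 1 - γ)) := by
  obtain ⟨C, hC, h1⟩ := exists_sq_rpow_mul_exp_le hγ
  obtain ⟨D, hD, h2⟩ := exists_sq_rpow_mul_exp_le (p := (⌊γ⌋₊ : ℝ) + 1) (by positivity)
  set G := (4 * Real.pi) ^ ((n : ℝ) / 2) with hG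
  have hG0 : 0 ≤ G := by positivity
  refine ⟨2 * C * G, by positivity, fun ε hε => ?_⟩
  obtain ⟨K, hK, h3⟩ := hu.exists_norm_profileError_le hγ hε
  refine ⟨2 * K ^ 2 * D * G, fun t ht => ?_⟩
  set N := ⌊γ⌋₊
  set c := 2 * (ε ^ 2 * (C * t ^ (-γ)) + K ^ 2 * (D * t ^ (-((N : ℝ) + 1)))) with hc
  have hc0 : 0 ≤ c := by positivity
  have hint := (integrable_exp_neg_mul_sq_norm_div_four n ht).const_mul c
  have hle : ∫ ξ in Metric.closedBall (0 : Rn n) 1, ‖profileError n N u t ξ‖ ^ 2 ≤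
      c * (G * t ^ (-((n : ℝ) / 2))) := by
    rw [hG, ← integral_exp_neg_mul_sq_norm_div_four n ht, ← integral_const_mul]
    refine le_trans ?_ (setIntegral_le_integral (s := Metric.closedBall (0 : Rn n) 1) hint
      (.of_forall fun ξ => by positivity))
    refine integral_mono_of_nonneg (.of_forall fun ξ => by positivity) hint.integrableOn ?_
    refine (ae_restrict_iff' Metric.isClosed_closedBall.measurableSet).2 (.of_forall fun ξ hξ => ?_)
    have hξ1 : ‖ξ‖ ≤ 1 := by simpa using hξ
    have h4 := h1 t ‖ξ‖ ht (norm_nonneg ξ)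
    have h5 := h2 t ‖ξ‖ ht (norm_nonneg ξ)
    have h6 : ‖ξ‖ ^ ((N : ℝ) + 1) = ‖ξ‖ ^ (N + 1) := by
      exact_mod_cast Real.rpow_natCast ‖ξ‖ (N + 1)
    rw [h6] at h5
    have h7 : Real.exp (-(t * ‖ξ‖ ^ 2) / 4) ^ 2 = Real.exp (-(t * ‖ξ‖ ^ 2) / 2) := by
      rw [← Real.exp_nat_mul]
      congr 1
      push_cast
      ring
    calc ‖profileError n N u t ξ‖ ^ 2
        ≤ ((ε * ‖ξ‖ ^ γ + K * ‖ξ‖ ^ (N + 1)) * Real.exp (-(t * ‖ξ‖ ^ 2) / 4)) ^ 2 :=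
          pow_le_pow_left₀ (norm_nonneg _) (h3 t ξ ht.le hξ1) 2
      _ = (ε * ‖ξ‖ ^ γ + K * ‖ξ‖ ^ (N + 1)) ^ 2 * Real.exp (-(t * ‖ξ‖ ^ 2) / 2) := by
          rw [mul_pow, h7]
      _ ≤ (2 * ((ε * ‖ξ‖ ^ γ) ^ 2 + (K * ‖ξ‖ ^ (N + 1)) ^ 2)) *
          Real.exp (-(t * ‖ξ‖ ^ 2) / 2) := by
          gcongr
          exact add_sq_le
      _ = 2 * (ε ^ 2 * ((‖ξ‖ ^ γ) ^ 2 * Real.exp (-(t * ‖ξ‖ ^ 2) / 2)) +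
          K ^ 2 * ((‖ξ‖ ^ (N + 1)) ^ 2 * Real.exp (-(t * ‖ξ‖ ^ 2) / 2))) := by ring
      _ ≤ 2 * (ε ^ 2 * (C * t ^ (-γ) * Real.exp (-(t * ‖ξ‖ ^ 2) / 4)) +
          K ^ 2 * (D * t ^ (-((N : ℝ) + 1)) * Real.exp (-(t * ‖ξ‖ ^ 2) / 4))) := by gcongr
      _ = c * Real.exp (-(t * ‖ξ‖ ^ 2) / 4) := by rw [hc]; ring
  refine (mul_le_mul_of_nonneg_left hle (by positivity)).trans (le_of_eq ?_)
  have e1 : t ^ ((n : ℝ) / 2 + γ) * t ^ (-((n : ℝ) / 2)) * t ^ (-γ) = 1 := by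
    rw [← Real.rpow_add ht, ← Real.rpow_add ht]
    ring_nf
    exact Real.rpow_zero t
  have e2 : t ^ ((n : ℝ) / 2 + γ) * t ^ (-((n : ℝ) / 2)) * t ^ (-((N : ℝ) + 1)) =
      t ^ (-((N : ℝ) + 1 - γ)) := by
    rw [← Real.rpow_add ht, ← Real.rpow_add ht]
    ring_nf
  rw [hc]
  linear_combination (2 * ε ^ 2 * C * G) * e1 + (2 * K ^ 2 * D * G) * e2

theorem MemL1w.tendsto_rpow_mul_integral_profileError {n : ℕ} {γ : ℝ} (hγ : 0 ≤ γ)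
    {u : Rn n → ℝ} (hu : MemL1w n γ u) :
    Tendsto (fun t : ℝ => t ^ ((n : ℝ) / 2 + γ) *
      ∫ ξ in Metric.closedBall (0 : Rn n) 1, ‖profileError n ⌊γ⌋₊ u t ξ‖ ^ 2) atTop (nhds 0) := by
  obtain ⟨A, hA, h⟩ := hu.exists_rpow_mul_integral_profileError_le hγ
  refine tendsto_order.2 ⟨fun a ha => ?_, fun η hη => ?_⟩
  · filter_upwards [eventually_ge_atTop 0] with t ht
    exact ha.trans_le (mul_nonneg (by positivity) (integral_nonneg fun ξ => by positivity))
  · obtain ⟨K, hK⟩ := h (Real.sqrt (η / (A + 1))) (Real.sqrt_pos.2 (by positivity))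
    have hlt : A * Real.sqrt (η / (A + 1)) ^ 2 + K * 0 < η := by
      rw [Real.sq_sqrt (by positivity), mul_zero, add_zero, ← mul_div_assoc,
        div_lt_iff₀ (by positivity)]
      nlinarith
    have hlim : Tendsto (fun t : ℝ => A * Real.sqrt (η / (A + 1)) ^ 2 +
        K * t ^ (-((⌊γ⌋₊ : ℝ) + 1 - γ))) atTop
        (nhds (A * Real.sqrt (η / (A + 1)) ^ 2 + K * 0)) :=
      ((tendsto_rpow_neg_atTop (by linarith [Nat.lt_floor_add_one γ])).const_mul K).const_add _
    filter_upwards [hlim.eventually (gt_mem_nhds hlt), eventually_gt_atTop 0] with t h1 ht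
    exact (hK t ht).trans_lt h1

theorem stmt3 (n : ℕ) (hn : 1 ≤ n) (γ : ℝ) (hγ : 0 ≤ γ)
    (u₀ : Rn n → ℝ) (hu₀ : MemL1w n γ u₀) :
    Tendsto (fun t : ℝ => t ^ ((n : ℝ) / 4 + γ / 2) *
      Real.sqrt (∫ ξ in Metric.closedBall (0 : Rn n) 1,
        ‖(E0 n t ξ : ℂ) * fourierHat n u₀ ξ -
          ∑ k ∈ Finset.range (⌊γ⌋₊ + 1), (e0 n k t ξ : ℂ) *
            ∑ j ∈ Finset.range (⌊γ⌋₊ - k + 1), mom n u₀ j ξ‖ ^ 2))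
      atTop (nhds 0) := by
  have h := (hu₀.tendsto_rpow_mul_integral_profileError hγ).sqrt
  rw [Real.sqrt_zero] at h
  refine h.congr' ?_
  filter_upwards [eventually_ge_atTop 0] with t ht
  have h2 : t ^ ((n : ℝ) / 2 + γ) = (t ^ ((n : ℝ) / 4 + γ / 2)) ^ 2 := by
    rw [← Real.rpow_natCast, ← Real.rpow_mul ht]
    congr 1
    push_cast
    ring
  rw [h2, Real.sqrt_mul (by positivity), Real.sqrt_sq (by positivity)]
  rfl
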